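/- Let E be a finite-dimensional real normed vector space equipped with an additive Haar measure μ, let F be a Minkowski gauge on E, let v ∈ E satisfy F(-v) < 1, and let F̃ : E → ℝ be continuous, positively homogeneous, positive on nonzero vectors, and satisfy the navigation identity F̃(y + F(y)•v) = F(y) for all y ∈ E. Then μ({w ∈ E : F̃(w) ≤ 1}) = μ({y ∈ E : F(y) ≤ 1}). (This is the pointwise form of the statement that the Busemann–Hausdorff volume form is unchanged by Zermelo navigation.) -/

import Mathlib

open MeasureTheory

/-- A convex positively homogeneous function is subadditive. -/
theorem ConvexOn.map_add_le_of_posHomogeneous {E : Type*} [AddCommGroup E] [Module ℝ E]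
    {F : E → ℝ} (hconv : ConvexOn ℝ Set.univ F)
    (hhom : ∀ c : ℝ, 0 ≤ c → ∀ y : E, F (c • y) = c * F y) (x y : E) :
    F (x + y) ≤ F x + F y := by
  have h := hconv.2 (Set.mem_univ x) (Set.mem_univ y)
    (by norm_num : (0 : ℝ) ≤ 1 / 2) (by norm_num : (0 : ℝ) ≤ 1 / 2) (by norm_num)
  rw [← smul_add, hhom _ (by norm_num)] at h
  simp only [smul_eq_mul] at h
  linarith

/-- The Haar measure of the closed unit ball of the navigation
metric `F̃` equals that of the closed unit ball of `F` (Busemann–Hausdorff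
volume form is unchanged by Zermelo navigation). -/
theorem zermelo_navigation_unit_ball_measure
    {E : Type*} [NormedAddCommGroup E] [NormedSpace ℝ E] [FiniteDimensional ℝ E]
    [MeasurableSpace E] [BorelSpace E]
    (μ : Measure E) [μ.IsAddHaarMeasure]
    (F : E → ℝ)
    (hFcont : Continuous F)
    (hFconv : ConvexOn ℝ Set.univ F)
    (hFhom : ∀ c : ℝ, 0 ≤ c → ∀ y : E, F (c • y) = c * F y)
    (hFpos : ∀ y : E, y ≠ 0 → 0 < F y)
    (v : E) (hv : F (-v) < 1)
    (Ft : E → ℝ)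
    (hFtcont : Continuous Ft)
    (hFthom : ∀ c : ℝ, 0 ≤ c → ∀ w : E, Ft (c • w) = c * Ft w)
    (hFtpos : ∀ w : E, w ≠ 0 → 0 < Ft w)
    (hnav : ∀ y : E, Ft (y + F y • v) = F y) :
    μ {w : E | Ft w ≤ 1} = μ {y : E | F y ≤ 1} := by
  have hsub := hFconv.map_add_le_of_posHomogeneous hFhom
  have hnonneg : ∀ y, 0 ≤ F y := fun y => by
    rcases eq_or_ne y 0 with rfl | hy
    · have h := hFhom 0 le_rfl (0 : E)
      rw [zero_smul, zero_mul] at h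
      exact h.ge
    · exact (hFpos y hy).le
  have hshift : ∀ (w : E) (s t : ℝ), s ≤ t → F (w - t • v) ≤ F (w - s • v) + (t - s) * F (-v) := by
    intro w s t hst
    have h := hsub (w - s • v) ((t - s) • (-v))
    rw [hFhom _ (sub_nonneg.2 hst)] at h
    convert h using 2
    module
  have hfix : ∀ w, F (w - Ft w • v) = Ft w := by
    intro w
    have hgap : 0 < 1 - F (-v) := sub_pos.2 hv
    set T := F w / (1 - F (-v)) with hT
    have hT0 : 0 ≤ T := div_nonneg (hnonneg w) hgap.le
    have hTF : T * (1 - F (-v)) = F w := div_mul_cancel₀ _ hgap.ne'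
    have hcont : ContinuousOn (fun t : ℝ => F (w - t • v) - t) (Set.Icc 0 T) := by fun_prop
    have hend : F (w - T • v) - T ≤ 0 := by
      have h := hshift w 0 T hT0
      rw [zero_smul, sub_zero, sub_zero] at h
      linarith
    have hstart : 0 ≤ F (w - (0 : ℝ) • v) - 0 := by
      simpa using hnonneg w
    obtain ⟨t, -, ht⟩ := intermediate_value_Icc' hT0 hcont ⟨hend, hstart⟩
    have ht' : F (w - t • v) = t := sub_eq_zero.1 ht
    have h := hnav (w - t • v)
    rw [ht', sub_add_cancel] at h
    rw [h, ht']
  have hball : {w : E | Ft w ≤ 1} = (fun w => w + -v) ⁻¹' {y : E | F y ≤ 1} := by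
    ext w
    simp only [Set.mem_ofPred_eq, Set.mem_preimage, ← sub_eq_add_neg]
    have hw := hfix w
    constructor
    · intro h
      have h' := hshift w (Ft w) 1 h
      rw [one_smul, hw] at h'
      nlinarith
    · intro h
      by_contra! hlt
      have h' := hshift w 1 (Ft w) hlt.le
      rw [one_smul, hw] at h'
      nlinarith
  rw [hball, measure_preimage_add_right]
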